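/- The star combinatory calculus has the Church–Rosser property: the one-step reduction relation is confluent, and hence each term has a unique normal form. -/

import Mathlib

namespace StarCalc

/-- Finite types over a single ground type `G`, closed under `→` and `*`. -/
inductive Ty : Type where
  | ground : Ty
  | arrow : Ty → Ty → Ty
  | star : Ty → Ty
deriving DecidableEq, Repr

/-- The type `G → ⋯ → G → G` with `n` arrows, the type of an `n`-ary function symbol. -/
def fnTy : ℕ → Ty
  | 0 => .ground
  | n + 1 => .arrow .ground (fnTy n)

/-- Terms of the star combinatory calculus over a family `F` of function symbols
(`F n` = the `n`-ary function symbols of the underlying first-order language). -/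
inductive Term (F : ℕ → Type) : Ty → Type where
  | var (n : ℕ) (σ : Ty) : Term F σ
  | fn {n : ℕ} (f : F n) : Term F (fnTy n)
  | pi (σ τ : Ty) : Term F (σ.arrow (τ.arrow σ))
  | sigma (ρ σ τ : Ty) :
      Term F ((ρ.arrow (σ.arrow τ)).arrow ((ρ.arrow σ).arrow (ρ.arrow τ)))
  | sing (σ : Ty) : Term F (σ.arrow σ.star)
  | union (σ : Ty) : Term F (σ.star.arrow (σ.star.arrow σ.star))
  | bigUnion (σ τ : Ty) : Term F (σ.star.arrow ((σ.arrow τ.star).arrow τ.star))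
  | app {σ τ : Ty} (t : Term F (σ.arrow τ)) (q : Term F σ) : Term F τ

variable {F : ℕ → Type}

/-- One-step reduction: apply one of the conversions
`Σtqr ⇝ tr(qr)`, `Πtq ⇝ t`, `⋃(𝔰t)q ⇝ qt`, `⋃(∪tq)r ⇝ ∪(⋃tr)(⋃qr)`
to a subterm. -/
inductive Step : {σ : Ty} → Term F σ → Term F σ → Prop where
  | sigma {ρ σ τ : Ty} (t : Term F (ρ.arrow (σ.arrow τ))) (q : Term F (ρ.arrow σ))
      (r : Term F ρ) :
      Step ((((Term.sigma ρ σ τ).app t).app q).app r) ((t.app r).app (q.app r))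
  | pi {σ τ : Ty} (t : Term F σ) (q : Term F τ) :
      Step (((Term.pi σ τ).app t).app q) t
  | bigUnion_sing {σ τ : Ty} (t : Term F σ) (q : Term F (σ.arrow τ.star)) :
      Step (((Term.bigUnion σ τ).app ((Term.sing σ).app t)).app q) (q.app t)
  | bigUnion_union {σ τ : Ty} (t q : Term F σ.star) (r : Term F (σ.arrow τ.star)) :
      Step (((Term.bigUnion σ τ).app (((Term.union σ).app t).app q)).app r)
        (((Term.union τ).app (((Term.bigUnion σ τ).app t).app r)).app
          (((Term.bigUnion σ τ).app q).app r))
  | app_left {σ τ : Ty} {t t' : Term F (σ.arrow τ)} (q : Term F σ) :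
      Step t t' → Step (t.app q) (t'.app q)
  | app_right {σ τ : Ty} (t : Term F (σ.arrow τ)) {q q' : Term F σ} :
      Step q q' → Step (t.app q) (t.app q')

/-- `t ⪰ q` : `t` reduces to `q` by finitely many (possibly zero) one-step reductions. -/
def Reduces {σ : Ty} (t q : Term F σ) : Prop :=
  Relation.ReflTransGen Step t q

/-- A term is normal if no one-step reduction applies to it. -/
def Normal {σ : Ty} (t : Term F σ) : Prop :=
  ∀ q : Term F σ, ¬ Step t q

/-- A term is strongly normalizable if there is no infinite chain of one-step
reductions starting from it. -/
def SN {σ : Ty} (t : Term F σ) : Prop :=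
  ¬ ∃ f : ℕ → Term F σ, f 0 = t ∧ ∀ n : ℕ, Step (f n) (f (n + 1))

/-- A term is closed if it contains no variables. -/
def Term.ClosedT : {σ : Ty} → Term F σ → Prop
  | _, .var _ _ => False
  | _, .app t q => t.ClosedT ∧ q.ClosedT
  | _, _ => True

end StarCalc

namespace StarCalc

section Confluence

variable {α : Type*} {r : α → α → Prop}

/-- **Newman's lemma**, localized at an accessible element: a locally confluent relation is
confluent below every element from which it terminates. -/
theorem confluent_of_acc_of_locally_confluent
    (h : ∀ a b c, r a b → r a c →
      ∃ d, Relation.ReflTransGen r b d ∧ Relation.ReflTransGen r c d)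
    {a : α} (ha : Acc (flip r) a) :
    ∀ b c, Relation.ReflTransGen r a b → Relation.ReflTransGen r a c →
      ∃ d, Relation.ReflTransGen r b d ∧ Relation.ReflTransGen r c d := by
  induction ha with
  | intro a _ ih =>
    intro b c hb hc
    rcases hb.cases_head with rfl | ⟨b₁, hab₁, hb₁b⟩
    · exact ⟨c, hc, .refl⟩
    rcases hc.cases_head with rfl | ⟨c₁, hac₁, hc₁c⟩
    · exact ⟨b, .refl, hb⟩
    obtain ⟨d, hb₁d, hc₁d⟩ := h a b₁ c₁ hab₁ hac₁
    obtain ⟨e, hbe, hde⟩ := ih b₁ hab₁ b d hb₁b hb₁d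
    obtain ⟨f, hef, hcf⟩ := ih c₁ hac₁ e c (hc₁d.trans hde) hc₁c
    exact ⟨f, hbe.trans hef, hcf⟩

theorem exists_irreducible_of_acc {a : α} (ha : Acc (flip r) a) :
    ∃ b, Relation.ReflTransGen r a b ∧ ∀ c, ¬ r b c := by
  induction ha with
  | intro a _ ih =>
    by_cases h : ∃ b, r a b
    · obtain ⟨b, hab⟩ := h
      obtain ⟨c, hbc, hc⟩ := ih b hab
      exact ⟨c, hbc.head hab, hc⟩
    · exact ⟨a, .refl, fun c hc => h ⟨c, hc⟩⟩

end Confluence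

theorem Reduces.refl {σ : Ty} (t : Term F σ) : Reduces t t := Relation.ReflTransGen.refl

theorem Step.reduces {σ : Ty} {t q : Term F σ} (h : Step t q) : Reduces t q :=
  Relation.ReflTransGen.single h

theorem Reduces.app {σ τ : Ty} {t t' : Term F (σ.arrow τ)} {q q' : Term F σ}
    (ht : Reduces t t') (hq : Reduces q q') : Reduces (t.app q) (t'.app q') :=
  Relation.ReflTransGen.trans
    (Relation.ReflTransGen.lift (fun x => Term.app x q) (fun _ _ => Step.app_left q) _ _ ht)
    (Relation.ReflTransGen.lift (Term.app t') (fun _ _ => Step.app_right t') _ _ hq)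

/-- Two terms are joinable if they have a common reduct. -/
def Joinable {σ : Ty} (t q : Term F σ) : Prop :=
  ∃ d, Reduces t d ∧ Reduces q d

theorem Joinable.symm {σ : Ty} {t q : Term F σ} : Joinable t q → Joinable q t :=
  fun ⟨d, h₁, h₂⟩ => ⟨d, h₂, h₁⟩

theorem Joinable.refl {σ : Ty} (t : Term F σ) : Joinable t t :=
  ⟨t, .refl t, .refl t⟩

theorem Joinable.app {σ τ : Ty} {t t' : Term F (σ.arrow τ)} {q q' : Term F σ}
    (ht : Joinable t t') (hq : Joinable q q') : Joinable (t.app q) (t'.app q') :=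
  let ⟨_, ht₁, ht₂⟩ := ht
  let ⟨_, hq₁, hq₂⟩ := hq
  ⟨_, ht₁.app hq₁, ht₂.app hq₂⟩

theorem joinable_of_step_sigma {ρ σ τ : Ty} {t : Term F (ρ.arrow (σ.arrow τ))}
    {q : Term F (ρ.arrow σ)} {r : Term F ρ} {b : Term F τ}
    (hb : Step ((((Term.sigma ρ σ τ).app t).app q).app r) b) :
    Joinable ((t.app r).app (q.app r)) b := by
  cases hb with
  | sigma => exact .refl _
  | app_left _ h =>
    cases h with
    | app_left _ h =>
      cases h with
      | app_left _ h => cases h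
      | app_right _ h =>
        exact ⟨_, (h.reduces.app (.refl _)).app (.refl _), (Step.sigma _ _ _).reduces⟩
    | app_right _ h =>
      exact ⟨_, .app (.refl _) (h.reduces.app (.refl _)), (Step.sigma _ _ _).reduces⟩
  | app_right _ h =>
    exact ⟨_, .app (.app (.refl _) h.reduces) (.app (.refl _) h.reduces),
      (Step.sigma _ _ _).reduces⟩

theorem joinable_of_step_pi {σ τ : Ty} {t : Term F σ} {q : Term F τ} {b : Term F σ}
    (hb : Step (((Term.pi σ τ).app t).app q) b) : Joinable t b := by
  cases hb with
  | pi => exact .refl _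
  | app_left _ h =>
    cases h with
    | app_left _ h => cases h
    | app_right _ h => exact ⟨_, h.reduces, (Step.pi _ _).reduces⟩
  | app_right _ h => exact ⟨_, .refl _, (Step.pi _ _).reduces⟩

theorem joinable_of_step_bigUnion_sing {σ τ : Ty} {t : Term F σ} {q : Term F (σ.arrow τ.star)}
    {b : Term F τ.star}
    (hb : Step (((Term.bigUnion σ τ).app ((Term.sing σ).app t)).app q) b) :
    Joinable (q.app t) b := by
  cases hb with
  | bigUnion_sing => exact .refl _
  | app_left _ h =>
    cases h with
    | app_left _ h => cases h
    | app_right _ h =>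
      cases h with
      | app_left _ h => cases h
      | app_right _ h =>
        exact ⟨_, .app (.refl _) h.reduces, (Step.bigUnion_sing _ _).reduces⟩
  | app_right _ h => exact ⟨_, h.reduces.app (.refl _), (Step.bigUnion_sing _ _).reduces⟩

theorem joinable_of_step_bigUnion_union {σ τ : Ty} {t q : Term F σ.star}
    {r : Term F (σ.arrow τ.star)} {b : Term F τ.star}
    (hb : Step (((Term.bigUnion σ τ).app (((Term.union σ).app t).app q)).app r) b) :
    Joinable (((Term.union τ).app (((Term.bigUnion σ τ).app t).app r)).app
      (((Term.bigUnion σ τ).app q).app r)) b := by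
  cases hb with
  | bigUnion_union => exact .refl _
  | app_left _ h =>
    cases h with
    | app_left _ h => cases h
    | app_right _ h =>
      cases h with
      | app_left _ h =>
        cases h with
        | app_left _ h => cases h
        | app_right _ h =>
          exact ⟨_, .app (.app (.refl _) (.app (.app (.refl _) h.reduces) (.refl _))) (.refl _),
            (Step.bigUnion_union _ _ _).reduces⟩
      | app_right _ h =>
        exact ⟨_, .app (.refl _) (.app (.app (.refl _) h.reduces) (.refl _)),
          (Step.bigUnion_union _ _ _).reduces⟩
  | app_right _ h =>
    exact ⟨_, .app (.app (.refl _) (.app (.refl _) h.reduces)) (.app (.refl _) h.reduces),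
      (Step.bigUnion_union _ _ _).reduces⟩

theorem Step.joinable {σ : Ty} {t a b : Term F σ} (ha : Step t a) (hb : Step t b) :
    Joinable a b := by
  induction ha with
  | sigma => exact joinable_of_step_sigma hb
  | pi => exact joinable_of_step_pi hb
  | bigUnion_sing => exact joinable_of_step_bigUnion_sing hb
  | bigUnion_union => exact joinable_of_step_bigUnion_union hb
  | app_left q h ih =>
    cases hb with
    | sigma => exact (joinable_of_step_sigma (h.app_left _)).symm
    | pi => exact (joinable_of_step_pi (h.app_left _)).symm
    | bigUnion_sing => exact (joinable_of_step_bigUnion_sing (h.app_left _)).symm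
    | bigUnion_union => exact (joinable_of_step_bigUnion_union (h.app_left _)).symm
    | app_left _ h' => exact (ih h').app (.refl _)
    | app_right _ h' => exact ⟨_, .app (.refl _) h'.reduces, .app h.reduces (.refl _)⟩
  | app_right t h ih =>
    cases hb with
    | sigma => exact (joinable_of_step_sigma (h.app_right _)).symm
    | pi => exact (joinable_of_step_pi (h.app_right _)).symm
    | bigUnion_sing => exact (joinable_of_step_bigUnion_sing (h.app_right _)).symm
    | bigUnion_union => exact (joinable_of_step_bigUnion_union (h.app_right _)).symm
    | app_left _ h' => exact ⟨_, .app h'.reduces (.refl _), .app (.refl _) h.reduces⟩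
    | app_right _ hq => exact Joinable.app (.refl _) (ih hq)

/-- Accessibility of a term for the converse of one-step reduction. -/
abbrev AccStep {σ : Ty} (t : Term F σ) : Prop :=
  Acc (flip Step) t

/-- Computability at a star type, relative to a predicate on the elements. -/
inductive StarRed {σ : Ty} (P : Term F σ → Prop) : Term F σ.star → Prop where
  | mk (t : Term F σ.star)
      (step : ∀ t', Step t t' → StarRed P t')
      (sing : ∀ s, t = (Term.sing σ).app s → P s)
      (union_left : ∀ a b, t = ((Term.union σ).app a).app b → StarRed P a)
      (union_right : ∀ a b, t = ((Term.union σ).app a).app b → StarRed P b) : StarRed P t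

/-- Tait's computability predicate. -/
def Red : (σ : Ty) → Term F σ → Prop
  | .ground => fun t => AccStep t
  | .arrow σ τ => fun t => ∀ s, Red σ s → Red τ (t.app s)
  | .star σ => StarRed (Red σ)

/-- The number of arguments the head of a term is still waiting for, before it forms a redex or,
for `𝔰` and `∪`, before it exceeds a canonical form. Terms with value `0` are neutral. -/
def Term.deficit : {σ : Ty} → Term F σ → ℕ
  | _, .var _ _ => 0
  | _, .fn _ => 0
  | _, .pi _ _ => 2
  | _, .sigma _ _ _ => 3
  | _, .sing _ => 2
  | _, .union _ => 3
  | _, .bigUnion _ _ => 2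
  | _, .app t _ => t.deficit - 1

/-- Whether a term is an application. -/
def Term.isApp : {σ : Ty} → Term F σ → Bool
  | _, .app _ _ => true
  | _, _ => false

theorem Step.isApp {σ : Ty} {t q : Term F σ} (h : Step t q) : t.isApp = true := by
  cases h <;> rfl

theorem StarRed.acc {σ : Ty} {P : Term F σ → Prop} {t : Term F σ.star} (h : StarRed P t) :
    AccStep t := by
  induction h with
  | mk t _ _ _ _ ih _ _ => exact ⟨t, ih⟩

theorem StarRed.of_step {σ : Ty} {P : Term F σ → Prop} {t t' : Term F σ.star}
    (h : StarRed P t) (ht : Step t t') : StarRed P t' := by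
  cases h with
  | mk _ step => exact step _ ht

theorem StarRed.of_deficit_eq_zero {σ : Ty} {P : Term F σ → Prop} {t : Term F σ.star}
    (h : t.deficit = 0) (ht : ∀ t', Step t t' → StarRed P t') : StarRed P t := by
  refine .mk t ht ?_ ?_ ?_ <;> (intros; subst_vars; simp [Term.deficit] at h)

theorem StarRed.union {σ : Ty} {P : Term F σ → Prop} {a b : Term F σ.star}
    (ha : StarRed P a) (hb : StarRed P b) : StarRed P (((Term.union σ).app a).app b) := by
  induction ha.acc generalizing b with
  | intro a _ iha =>
    induction hb.acc with
    | intro b _ ihb =>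
      refine .mk _ ?_ ?_ ?_ ?_
      · intro t' h
        cases h with
        | app_left _ h =>
          cases h with
          | app_left _ h => cases h
          | app_right _ h => exact iha _ h (ha.of_step h) hb
        | app_right _ h => exact ihb _ h (hb.of_step h)
      · intro s h
        cases h
      · intro a' b' h
        cases h
        exact ha
      · intro a' b' h
        cases h
        exact hb

theorem StarRed.sing {σ : Ty} {P : Term F σ → Prop}
    (hP : ∀ t t', P t → Step t t' → P t') {s : Term F σ}
    (hs : P s) (hacc : AccStep s) : StarRed P ((Term.sing σ).app s) := by
  induction hacc with
  | intro s _ ih =>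
    refine .mk _ ?_ ?_ ?_ ?_
    · intro t' h
      cases h with
      | app_left _ h => cases h
      | app_right _ h => exact ih _ h (hP _ _ hs h)
    · intro s' h
      cases h
      exact hs
    · intro a b h
      cases h
    · intro a b h
      cases h

theorem AccStep.of_app_left {σ τ : Ty} {t : Term F (σ.arrow τ)} {s : Term F σ}
    (h : AccStep (t.app s)) : AccStep t :=
  InvImage.accessible (fun t => Term.app t s) h |> Subrelation.accessible (Step.app_left s)

/-- The three fundamental properties of computability: computable terms are strongly normalizing,
they are closed under reduction, and a neutral term is computable once all its reducts are. -/
theorem red_properties (σ : Ty) :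
    (∀ t : Term F σ, Red σ t → AccStep t) ∧
    (∀ t t' : Term F σ, Red σ t → Step t t' → Red σ t') ∧
    (∀ t : Term F σ, t.deficit = 0 → (∀ t', Step t t' → Red σ t') → Red σ t) := by
  induction σ with
  | ground =>
    exact ⟨fun _ h => h, fun _ _ h h' => h.inv h', fun t _ h => ⟨t, h⟩⟩
  | star σ _ =>
    exact ⟨fun _ h => StarRed.acc h, fun _ _ h h' => StarRed.of_step h h',
      fun _ h h' => StarRed.of_deficit_eq_zero h h'⟩
  | arrow σ τ ihσ ihτ =>
    obtain ⟨accσ, stepσ, neutralσ⟩ := ihσ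
    obtain ⟨accτ, stepτ, neutralτ⟩ := ihτ
    refine ⟨fun t ht => ?_, fun t t' ht h s hs => stepτ _ _ (ht s hs) (h.app_left s), ?_⟩
    · exact (accτ _ (ht (.var 0 σ) (neutralσ _ rfl fun t' h => by cases h))).of_app_left
    · intro t h0 ht s hs
      induction accσ s hs with
      | intro s _ ih =>
        refine neutralτ _ (by simp [Term.deficit, h0]) fun u hu => ?_
        cases hu with
        | app_left _ h => exact ht _ h s hs
        | app_right _ h => exact ih _ h (stepσ _ _ hs h)
        | _ => simp [Term.deficit] at h0

theorem Red.acc {σ : Ty} {t : Term F σ} (h : Red σ t) : AccStep t :=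
  (red_properties σ).1 t h

theorem Red.of_step {σ : Ty} {t t' : Term F σ} (h : Red σ t) (ht : Step t t') : Red σ t' :=
  (red_properties σ).2.1 t t' h ht

theorem Red.of_deficit_eq_zero {σ : Ty} {t : Term F σ} (h : t.deficit = 0)
    (ht : ∀ t', Step t t' → Red σ t') : Red σ t :=
  (red_properties σ).2.2 t h ht

theorem Red.pi (σ τ : Ty) : Red _ (Term.pi σ τ : Term F _) := by
  intro t ht q hq
  induction ht.acc generalizing q with
  | intro t _ iht =>
    induction hq.acc with
    | intro q _ ihq =>
      refine .of_deficit_eq_zero rfl fun u hu => ?_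
      cases hu with
      | pi => exact ht
      | app_left _ h =>
        cases h with
        | app_left _ h => cases h
        | app_right _ h => exact iht _ h (ht.of_step h) q hq
      | app_right _ h => exact ihq _ h (hq.of_step h)

theorem Red.sigma (ρ σ τ : Ty) : Red _ (Term.sigma ρ σ τ : Term F _) := by
  intro t ht q hq r hr
  induction ht.acc generalizing q r with
  | intro t _ iht =>
    induction hq.acc generalizing r with
    | intro q _ ihq =>
      induction hr.acc with
      | intro r _ ihr =>
        refine .of_deficit_eq_zero rfl fun u hu => ?_
        cases hu with
        | sigma => exact ht r hr _ (hq r hr)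
        | app_left _ h =>
          cases h with
          | app_left _ h =>
            cases h with
            | app_left _ h => cases h
            | app_right _ h => exact iht _ h (ht.of_step h) q hq r hr
          | app_right _ h => exact ihq _ h (hq.of_step h) r hr
        | app_right _ h => exact ihr _ h (hr.of_step h)

theorem Red.bigUnion (σ τ : Ty) : Red _ (Term.bigUnion σ τ : Term F _) := by
  intro t ht q hq
  change StarRed (Red σ) t at ht
  induction ht generalizing q with
  | mk t step sing union_left union_right iht ihl ihr =>
    induction hq.acc with
    | intro q _ ihq =>
      refine .of_deficit_eq_zero rfl fun u hu => ?_
      cases hu with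
      | bigUnion_sing s _ => exact hq s (sing s rfl)
      | bigUnion_union a b _ => exact StarRed.union (ihl a b rfl q hq) (ihr a b rfl q hq)
      | app_left _ h =>
        cases h with
        | app_left _ h => cases h
        | app_right _ h => exact iht _ h q hq
      | app_right _ h => exact ihq _ h (hq.of_step h)

theorem Term.red {σ : Ty} (t : Term F σ) : Red σ t := by
  induction t with
  | var n σ => exact .of_deficit_eq_zero rfl fun _ h => by cases h
  | fn f => exact .of_deficit_eq_zero rfl fun _ h => by simpa [Term.isApp] using h.isApp
  | pi σ τ => exact .pi σ τ
  | sigma ρ σ τ => exact .sigma ρ σ τ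
  | sing σ => exact fun s hs => StarRed.sing (fun _ _ h h' => h.of_step h') hs hs.acc
  | union σ => exact fun a ha b hb => StarRed.union ha hb
  | bigUnion σ τ => exact .bigUnion σ τ
  | app t q iht ihq => exact iht q ihq

theorem Normal.eq_of_reduces {σ : Ty} {t q : Term F σ} (ht : Normal t) (h : Reduces t q) :
    t = q := by
  rcases Relation.ReflTransGen.cases_head h with rfl | ⟨u, hu, _⟩
  · rfl
  · exact (ht u hu).elim

end StarCalc

open StarCalc in
/-- The star combinatory calculus has the Church–Rosser property:
the one-step reduction relation is confluent, and hence each term has a unique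
normal form. -/
theorem star_calculus_church_rosser (F : ℕ → Type) (c : F 0) :
    (∀ {σ : Ty} (t t₁ t₂ : Term F σ), Reduces t t₁ → Reduces t t₂ →
      ∃ t₃ : Term F σ, Reduces t₁ t₃ ∧ Reduces t₂ t₃) ∧
    (∀ {σ : Ty} (t : Term F σ), ∃! n : Term F σ, Reduces t n ∧ Normal n) := by
  have confluent : ∀ {σ : Ty} (t t₁ t₂ : Term F σ), Reduces t t₁ → Reduces t t₂ →
      ∃ t₃ : Term F σ, Reduces t₁ t₃ ∧ Reduces t₂ t₃ := fun t =>
    confluent_of_acc_of_locally_confluent (fun _ _ _ => Step.joinable) t.red.acc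
  refine ⟨confluent, fun t => ?_⟩
  obtain ⟨n, htn, hn⟩ := exists_irreducible_of_acc t.red.acc
  refine ⟨n, ⟨htn, hn⟩, fun m ⟨htm, hm⟩ => ?_⟩
  obtain ⟨d, hmd, hnd⟩ := confluent t m n htm htn
  rw [hm.eq_of_reduces hmd, Normal.eq_of_reduces hn hnd]
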